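/- Define M_k(d;n,A) := Σ d̃(λ)^k, the sum over all marked set partitions λ of [n] with exactly A open blocks (with M_0(d;0,0) = 1, and M_k(d;0,A) = 0 for (k,A) ≠ (0,0) appropriately). Then for all n ≥ 1, k ≥ 0, and A ≥ 0: M_k(d;n,A) = Σ_{j=0}^{k} C(k,j)(A−1)^{k−j} M_j(d;n−1,A−1) + Σ_{j=0}^{k} C(k,j) A^{k−j} M_j(d;n−1,A) + A·Σ_{j=0}^{k} C(k,j)(A−1)^{k−j} M_j(d;n−1,A) + (A+1)·Σ_{j=0}^{k} C(k,j) A^{k−j} M_j(d;n−1,A+1). -/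

import Mathlib

open Finset

/-- Set partitions of `[n]`, modeled as finpartitions of `Fin n`. -/
abbrev SetPartition (n : ℕ) := Finpartition (Finset.univ : Finset (Fin n))

/-- The `n`-th Bell number: the number of set partitions of `[n]`. -/
def bell (n : ℕ) : ℕ := Fintype.card (SetPartition n)

/-- `i` and `j` lie in the same block of the partition. -/
def SameBlock {n : ℕ} (P : SetPartition n) (i j : Fin n) : Prop :=
  ∃ b ∈ P.parts, i ∈ b ∧ j ∈ b

/-- `i` is the smallest element of its block. -/
def IsFirst {n : ℕ} (P : SetPartition n) (i : Fin n) : Prop :=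
  ∀ j, SameBlock P i j → i ≤ j

/-- `i` is the largest element of its block. -/
def IsLast {n : ℕ} (P : SetPartition n) (i : Fin n) : Prop :=
  ∀ j, SameBlock P i j → j ≤ i

/-- `(i, j)` is an arc: `i < j`, both in the same block, and `j` is the smallest
element of that block greater than `i`. -/
def IsArc {n : ℕ} (P : SetPartition n) (i j : Fin n) : Prop :=
  i < j ∧ SameBlock P i j ∧ ∀ k, i < k → k < j → ¬ SameBlock P i k

/-- The dimension exponent `d(λ) = Σ_blocks (max - min + 1) - n`. -/
def dimExp {n : ℕ} (P : SetPartition n) : ℤ :=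
  (∑ b ∈ P.parts.attach,
      (((b.1.max' (P.nonempty_of_mem_parts b.2)).val : ℤ)
        - ((b.1.min' (P.nonempty_of_mem_parts b.2)).val : ℤ) + 1)) - n

/-- The intertwining exponent (number of 2-crossings): the number of pairs of arcs
`(i₁,j₁), (i₂,j₂)` with `i₁ < i₂ < j₁ < j₂`. -/
noncomputable def inter {n : ℕ} (P : SetPartition n) : ℕ :=
  Set.ncard {q : (Fin n × Fin n) × (Fin n × Fin n) |
    IsArc P q.1.1 q.1.2 ∧ IsArc P q.2.1 q.2.2 ∧
    q.1.1 < q.2.1 ∧ q.2.1 < q.1.2 ∧ q.1.2 < q.2.2}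

/-- A marked set partition of `[n]`: a set partition together with a designation of
each block as open or closed (`opens` is the set of open blocks). -/
structure MarkedPartition (n : ℕ) where
  part : SetPartition n
  opens : Finset (Finset (Fin n))
  opens_subset : opens ⊆ part.parts

/-- The number of open blocks. -/
def MarkedPartition.o {n : ℕ} (μ : MarkedPartition n) : ℕ := μ.opens.card

/-- The generalized dimension exponent of a marked set partition:
`d̃(λ) = (Σ_{closed blocks} max B) - (Σ_{all blocks} min B) + ℓ(λ) + n(o(λ) - 1)`,
where elements of `[n] = {1, …, n}` are identified with `x.val + 1` for `x : Fin n`. -/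
def MarkedPartition.dtilde {n : ℕ} (μ : MarkedPartition n) : ℤ :=
  (∑ b ∈ (μ.part.parts \ μ.opens).attach,
      (((b.1.max' (μ.part.nonempty_of_mem_parts (Finset.mem_sdiff.mp b.2).1)).val : ℤ) + 1))
  - (∑ b ∈ μ.part.parts.attach,
      (((b.1.min' (μ.part.nonempty_of_mem_parts b.2)).val : ℤ) + 1))
  + μ.part.parts.card + (n : ℤ) * ((μ.o : ℤ) - 1)

noncomputable instance markedPartitionFintype (n : ℕ) : Fintype (MarkedPartition n) :=
  Fintype.ofInjective (fun μ => (μ.part, μ.opens)) (by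
    rintro ⟨p₁, o₁, h₁⟩ ⟨p₂, o₂, h₂⟩ h
    simpa using h)

/-- `M_k(d; n, A) = Σ_{marked λ ∈ Π(n), o(λ) = A} d̃(λ)^k`. -/
noncomputable def Mdim (k n : ℕ) (A : ℤ) : ℤ :=
  ∑ μ ∈ Finset.univ.filter (fun μ : MarkedPartition n => (μ.o : ℤ) = A),
    (μ.dtilde) ^ k

/-- The trace on `[n]` of a subset of `[n + 1]`. -/
def restrictLast {n : ℕ} (c : Finset (Fin (n + 1))) : Finset (Fin n) :=
  univ.filter fun i => i.castSucc ∈ c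

/-- A subset of `[n]` viewed as a subset of `[n + 1]`. -/
def liftSucc {n : ℕ} (b : Finset (Fin n)) : Finset (Fin (n + 1)) :=
  b.map Fin.castSuccEmb

section restrictLift

variable {n : ℕ}

@[simp] lemma mem_restrictLast {c : Finset (Fin (n + 1))} {i : Fin n} :
    i ∈ restrictLast c ↔ i.castSucc ∈ c := by simp [restrictLast]

@[simp] lemma castSucc_mem_liftSucc {b : Finset (Fin n)} {i : Fin n} :
    i.castSucc ∈ liftSucc b ↔ i ∈ b := by simp [liftSucc]

@[simp] lemma last_notMem_liftSucc {b : Finset (Fin n)} : Fin.last n ∉ liftSucc b := by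
  simp [liftSucc]

@[simp] lemma restrictLast_liftSucc (b : Finset (Fin n)) : restrictLast (liftSucc b) = b := by
  ext; simp

@[simp] lemma restrictLast_insert_liftSucc (b : Finset (Fin n)) :
    restrictLast (insert (Fin.last n) (liftSucc b)) = b := by
  ext; simp

lemma liftSucc_injective : Function.Injective (liftSucc (n := n)) :=
  Function.LeftInverse.injective restrictLast_liftSucc

lemma liftSucc_restrictLast {c : Finset (Fin (n + 1))} (hc : Fin.last n ∉ c) :
    liftSucc (restrictLast c) = c := by
  ext i
  cases i using Fin.lastCases <;> simp [hc]

lemma insert_liftSucc_restrictLast {c : Finset (Fin (n + 1))} (hc : Fin.last n ∈ c) :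
    insert (Fin.last n) (liftSucc (restrictLast c)) = c := by
  ext i
  cases i using Fin.lastCases <;> simp [hc]

@[simp] lemma liftSucc_empty : liftSucc (∅ : Finset (Fin n)) = ∅ := rfl

lemma insert_last_ne_liftSucc (b b' : Finset (Fin n)) :
    insert (Fin.last n) (liftSucc b) ≠ liftSucc b' := fun h =>
  last_notMem_liftSucc (h ▸ mem_insert_self _ _)

lemma insert_last_notMem_image_liftSucc (b : Finset (Fin n)) (s : Finset (Finset (Fin n))) :
    insert (Fin.last n) (liftSucc b) ∉ s.image liftSucc := by
  simp only [mem_image, not_exists, not_and]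
  exact fun b' _ h => insert_last_ne_liftSucc b b' h.symm

end restrictLift

/-- The largest element of `b ⊆ [n]`, in `{1, …, n}`, and `0` if `b` is empty. -/
def topValue {n : ℕ} (b : Finset (Fin n)) : ℤ :=
  if h : b.Nonempty then ((b.max' h).val : ℤ) + 1 else 0

/-- The smallest element of `b ⊆ [n]`, in `{1, …, n}`, and `0` if `b` is empty. -/
def botValue {n : ℕ} (b : Finset (Fin n)) : ℤ :=
  if h : b.Nonempty then ((b.min' h).val : ℤ) + 1 else 0

section values

variable {n : ℕ}

@[simp] lemma topValue_liftSucc (b : Finset (Fin n)) : topValue (liftSucc b) = topValue b := by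
  unfold topValue
  by_cases h : b.Nonempty
  · have h' : (liftSucc b).Nonempty := by simpa [liftSucc] using h
    have : (liftSucc b).max' h' = (b.max' h).castSucc :=
      (max'_eq_iff _ _ _).2 ⟨by simp [max'_mem], fun i => by
        cases i using Fin.lastCases <;> simp +contextual [le_max']⟩
    rw [dif_pos h, dif_pos h', this, Fin.val_castSucc]
  · simp_all [liftSucc]

@[simp] lemma botValue_liftSucc (b : Finset (Fin n)) : botValue (liftSucc b) = botValue b := by
  unfold botValue
  by_cases h : b.Nonempty
  · have h' : (liftSucc b).Nonempty := by simpa [liftSucc] using h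
    have : (liftSucc b).min' h' = (b.min' h).castSucc :=
      (min'_eq_iff _ _ _).2 ⟨by simp [min'_mem], fun i => by
        cases i using Fin.lastCases <;> simp +contextual [min'_le]⟩
    rw [dif_pos h, dif_pos h', this, Fin.val_castSucc]
  · simp_all [liftSucc]

@[simp] lemma topValue_insert_last (b : Finset (Fin n)) :
    topValue (insert (Fin.last n) (liftSucc b)) = n + 1 := by
  have : (insert (Fin.last n) (liftSucc b)).max' (insert_nonempty _ _) = Fin.last n :=
    (max'_eq_iff _ _ _).2 ⟨mem_insert_self _ _, fun i _ => Fin.le_last i⟩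
  rw [topValue, dif_pos (insert_nonempty _ _), this, Fin.val_last]

lemma botValue_insert_last (b : Finset (Fin n)) :
    botValue (insert (Fin.last n) (liftSucc b)) = if b = ∅ then (n : ℤ) + 1 else botValue b := by
  split_ifs with hb
  · subst hb
    simp [botValue]
  · have h := nonempty_iff_ne_empty.2 hb
    have : (insert (Fin.last n) (liftSucc b)).min' (insert_nonempty _ _) = (b.min' h).castSucc :=
      (min'_eq_iff _ _ _).2 ⟨by simp [min'_mem], fun i => by
        cases i using Fin.lastCases <;> simp +contextual [min'_le, Fin.le_last]⟩
    rw [botValue, botValue, dif_pos (insert_nonempty _ _), dif_pos h, this, Fin.val_castSucc]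

end values

namespace MarkedPartition

variable {n : ℕ}

@[ext] lemma ext_parts {μ ν : MarkedPartition n} (hp : μ.part.parts = ν.part.parts)
    (ho : μ.opens = ν.opens) : μ = ν := by
  obtain ⟨p, o, h⟩ := μ
  obtain ⟨q, o', h'⟩ := ν
  obtain rfl : p = q := Finpartition.ext hp
  obtain rfl : o = o' := ho
  rfl

lemma empty_notMem_parts (μ : MarkedPartition n) : ∅ ∉ μ.part.parts := μ.part.bot_notMem

lemma empty_notMem_opens (μ : MarkedPartition n) : ∅ ∉ μ.opens :=
  fun h => μ.empty_notMem_parts (μ.opens_subset h)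

lemma dtilde_eq (μ : MarkedPartition n) :
    μ.dtilde = ∑ b ∈ μ.part.parts \ μ.opens, topValue b - ∑ b ∈ μ.part.parts, botValue b
      + μ.part.parts.card + (n : ℤ) * ((μ.o : ℤ) - 1) := by
  rw [dtilde, ← sum_attach (μ.part.parts \ μ.opens), ← sum_attach μ.part.parts]
  congr 3
  · refine sum_congr rfl fun b _ => ?_
    rw [topValue, dif_pos]
  · refine sum_congr rfl fun b _ => ?_
    rw [botValue, dif_pos]

/-- Add the element `n + 1` to the block `b`, which is either open or empty; the resulting
block is open if and only if `t` is true. -/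
def addLast (μ : MarkedPartition n) (b : Finset (Fin n)) (t : Bool)
    (hb : b ∈ insert ∅ μ.opens) : MarkedPartition (n + 1) where
  part := Finpartition.ofExistsUnique
    (insert (insert (Fin.last n) (liftSucc b)) ((μ.part.parts.erase b).image liftSucc))
    (fun _ _ => subset_univ _)
    (fun i _ => by
      cases i using Fin.lastCases with
      | last =>
        refine ⟨insert (Fin.last n) (liftSucc b), by simp, ?_⟩
        rintro c ⟨hc, hi⟩
        rcases mem_insert.1 hc with rfl | hc
        · rfl
        · obtain ⟨c, -, rfl⟩ := mem_image.1 hc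
          exact absurd hi last_notMem_liftSucc
      | cast i =>
        obtain ⟨c, ⟨hc, hi⟩, huniq⟩ := μ.part.existsUnique_mem (mem_univ i)
        have key : i ∈ b → b = c := fun hib => by
          rcases mem_insert.1 hb with rfl | hb
          · simp at hib
          · exact huniq b ⟨μ.opens_subset hb, hib⟩
        by_cases hbc : b = c
        · subst hbc
          refine ⟨insert (Fin.last n) (liftSucc b), by simp [hi], ?_⟩
          rintro c ⟨hc, hic⟩
          rcases mem_insert.1 hc with rfl | hc
          · rfl
          · obtain ⟨d, hd, rfl⟩ := mem_image.1 hc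
            exact absurd (huniq d ⟨mem_of_mem_erase hd, by simpa using hic⟩) (ne_of_mem_erase hd)
        · refine ⟨liftSucc c, ⟨mem_insert_of_mem (mem_image_of_mem _
            (mem_erase.2 ⟨Ne.symm hbc, hc⟩)), by simpa using hi⟩, ?_⟩
          rintro d ⟨hd, hid⟩
          rcases mem_insert.1 hd with rfl | hd
          · exact absurd (key (by simpa using hid)) hbc
          · obtain ⟨e, he, rfl⟩ := mem_image.1 hd
            rw [huniq e ⟨mem_of_mem_erase he, by simpa using hid⟩])
    (by
      simp only [mem_insert, mem_image, mem_erase, not_or, not_exists, not_and]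
      refine ⟨(insert_ne_empty _ _).symm, fun c hc h => μ.empty_notMem_parts ?_⟩
      rw [← liftSucc_empty] at h
      exact liftSucc_injective h ▸ hc.2)
  opens := (if t then {insert (Fin.last n) (liftSucc b)} else ∅) ∪
    (μ.opens.erase b).image liftSucc
  opens_subset := by
    refine union_subset ?_ ((image_subset_image (erase_subset_erase b μ.opens_subset)).trans
      (subset_insert _ _))
    split_ifs <;> simp

section addLast

variable (μ : MarkedPartition n) (b : Finset (Fin n)) (t : Bool) (hb : b ∈ insert ∅ μ.opens)

lemma parts_addLast : (μ.addLast b t hb).part.parts =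
    insert (insert (Fin.last n) (liftSucc b)) ((μ.part.parts.erase b).image liftSucc) := rfl

lemma opens_addLast : (μ.addLast b t hb).opens =
    (if t then {insert (Fin.last n) (liftSucc b)} else ∅) ∪
      (μ.opens.erase b).image liftSucc := rfl

lemma o_addLast : ((μ.addLast b t hb).o : ℤ) =
    μ.o - (if b = ∅ then 0 else 1) + (if t then 1 else 0) := by
  have h1 : ((μ.opens.erase b).card : ℤ) = μ.o - (if b = ∅ then 0 else 1) := by
    split_ifs with h
    · rw [h, erase_eq_of_notMem μ.empty_notMem_opens, o, sub_zero]
    · have := card_erase_add_one (mem_of_mem_insert_of_ne hb h)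
      rw [o]
      omega
  rw [o, opens_addLast, ← h1, card_union_of_disjoint, card_image_of_injective _ liftSucc_injective]
  · cases t <;> simp [add_comm]
  · cases t
    · simp
    · simpa using insert_last_notMem_image_liftSucc b (μ.opens.erase b)

lemma closed_addLast : (μ.addLast b t hb).part.parts \ (μ.addLast b t hb).opens =
    (if t then ∅ else {insert (Fin.last n) (liftSucc b)}) ∪
      (μ.part.parts \ μ.opens).image liftSucc := by
  have h1 : (μ.part.parts.erase b) \ (μ.opens.erase b) = μ.part.parts \ μ.opens := by
    have := μ.empty_notMem_parts
    ext c
    simp only [mem_sdiff, mem_erase]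
    grind
  rw [parts_addLast, opens_addLast, ← h1, image_sdiff _ _ liftSucc_injective]
  have h2 := insert_last_notMem_image_liftSucc b (μ.opens.erase b)
  have h3 := insert_last_notMem_image_liftSucc b (μ.part.parts.erase b)
  cases t <;> grind

lemma dtilde_addLast : (μ.addLast b t hb).dtilde =
    μ.dtilde + ((μ.addLast b t hb).o - 1 + (if t then 0 else 1)) := by
  have hclosed : ∑ c ∈ (μ.addLast b t hb).part.parts \ (μ.addLast b t hb).opens, topValue c =
      (if t then 0 else (n : ℤ) + 1) + ∑ c ∈ μ.part.parts \ μ.opens, topValue c := by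
    rw [closed_addLast, sum_union, sum_image liftSucc_injective.injOn]
    · cases t <;> simp
    · cases t
      · simpa using insert_last_notMem_image_liftSucc b (μ.part.parts \ μ.opens)
      · simp
  have hall : ∑ c ∈ (μ.addLast b t hb).part.parts, (botValue c - 1) =
      (if b = ∅ then (n : ℤ) else 0) + ∑ c ∈ μ.part.parts, (botValue c - 1) := by
    rw [parts_addLast, sum_insert (insert_last_notMem_image_liftSucc _ _),
      sum_image liftSucc_injective.injOn, botValue_insert_last]
    simp only [botValue_liftSucc]
    split_ifs with h
    · rw [h, erase_eq_of_notMem μ.empty_notMem_parts]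
      ring
    · rw [add_sum_erase _ (fun c => botValue c - 1)
        (μ.opens_subset (mem_of_mem_insert_of_ne hb h)), zero_add]
  simp only [sum_sub_distrib, sum_const, nsmul_eq_mul, mul_one] at hall
  have ho := μ.o_addLast b t hb
  rw [dtilde_eq, dtilde_eq, hclosed]
  push_cast
  generalize (μ.addLast b t hb).o = o' at *
  rw [ho]
  split_ifs at * <;> linarith

lemma parts_eq_of_addLast :
    μ.part.parts = ((μ.addLast b t hb).part.parts.image restrictLast).erase ∅ := by
  have := μ.empty_notMem_parts
  have := @μ.opens_subset
  rw [parts_addLast, image_insert, image_image, restrictLast_insert_liftSucc,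
    show restrictLast ∘ liftSucc = (id : Finset (Fin n) → _) from funext restrictLast_liftSucc,
    image_id]
  grind

lemma opens_eq_of_addLast :
    μ.opens = ((insert (insert (Fin.last n) (liftSucc b))
      (μ.addLast b t hb).opens).image restrictLast).erase ∅ := by
  have := μ.empty_notMem_opens
  rw [opens_addLast, image_insert, image_union, image_image, restrictLast_insert_liftSucc,
    show restrictLast ∘ liftSucc = (id : Finset (Fin n) → _) from funext restrictLast_liftSucc,
    image_id]
  cases t
  · simp only [Bool.false_eq_true, if_false, image_empty]
    grind
  · simp only [if_true, image_singleton, restrictLast_insert_liftSucc]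
    grind

lemma mem_opens_addLast :
    insert (Fin.last n) (liftSucc b) ∈ (μ.addLast b t hb).opens ↔ t = true := by
  have := insert_last_notMem_image_liftSucc b (μ.opens.erase b)
  rw [opens_addLast, mem_union]
  cases t <;> simp [this]

end addLast

lemma addLast_injective {μ ν : MarkedPartition n} {b c : Finset (Fin n)} {t u : Bool}
    {hb : b ∈ insert ∅ μ.opens} {hc : c ∈ insert ∅ ν.opens}
    (h : μ.addLast b t hb = ν.addLast c u hc) : μ = ν ∧ b = c ∧ t = u := by
  have hbc : b = c := by
    have hb' : insert (Fin.last n) (liftSucc b) ∈ (μ.addLast b t hb).part.parts := by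
      simp [parts_addLast]
    have hc' : insert (Fin.last n) (liftSucc c) ∈ (μ.addLast b t hb).part.parts := by
      simp [h, parts_addLast]
    rw [← restrictLast_insert_liftSucc b, ← restrictLast_insert_liftSucc c,
      (μ.addLast b t hb).part.eq_of_mem_parts hb' hc' (mem_insert_self _ _) (mem_insert_self _ _)]
  subst hbc
  refine ⟨ext_parts ?_ ?_, rfl, ?_⟩
  · rw [μ.parts_eq_of_addLast b t hb, h, ← ν.parts_eq_of_addLast]
  · rw [μ.opens_eq_of_addLast b t hb, h, ← ν.opens_eq_of_addLast]
  · rw [Bool.eq_iff_iff, ← μ.mem_opens_addLast b t hb, h, mem_opens_addLast]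

/-- Remove the element `n + 1`; what is left of its block, if nonempty, becomes open. -/
def removeLast (ν : MarkedPartition (n + 1)) : MarkedPartition n where
  part := Finpartition.ofExistsUnique ((ν.part.parts.image restrictLast).erase ∅)
    (fun _ _ => subset_univ _)
    (fun i _ => by
      obtain ⟨c, ⟨hc, hi⟩, huniq⟩ := ν.part.existsUnique_mem (mem_univ i.castSucc)
      have hi' := mem_restrictLast.2 hi
      refine ⟨restrictLast c,
        ⟨mem_erase.2 ⟨ne_empty_of_mem hi', mem_image_of_mem _ hc⟩, hi'⟩, ?_⟩
      rintro d ⟨hd, hid⟩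
      obtain ⟨e, he, rfl⟩ := mem_image.1 (mem_of_mem_erase hd)
      rw [huniq e ⟨he, mem_restrictLast.1 hid⟩])
    (notMem_erase _ _)
  opens := ((insert (ν.part.part (Fin.last n)) ν.opens).image restrictLast).erase ∅
  opens_subset := erase_subset_erase _ <| image_subset_image <|
    insert_subset (ν.part.part_mem.2 (mem_univ _)) ν.opens_subset

lemma exists_addLast_eq (ν : MarkedPartition (n + 1)) :
    ∃ (μ : MarkedPartition n) (b : Finset (Fin n)) (t : Bool) (hb : b ∈ insert ∅ μ.opens),
      μ.addLast b t hb = ν := by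
  set c := ν.part.part (Fin.last n) with hcdef
  have hc : c ∈ ν.part.parts := ν.part.part_mem.2 (mem_univ _)
  have hlast : Fin.last n ∈ c := ν.part.mem_part (mem_univ _)
  have hins := insert_liftSucc_restrictLast hlast
  have hnot : ∀ d ∈ ν.part.parts, d ≠ c → Fin.last n ∉ d := fun d hd hdc hl =>
    hdc (ν.part.eq_of_mem_parts hd hc hl hlast)
  have hdisj : ∀ d ∈ ν.part.parts, d ≠ c →
      restrictLast d ≠ ∅ ∧ restrictLast d ≠ restrictLast c := by
    intro d hd hdc
    have hne : restrictLast d ≠ ∅ := fun h => ν.empty_notMem_parts <| by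
      have := liftSucc_restrictLast (hnot d hd hdc)
      rw [h, liftSucc_empty] at this
      rwa [this]
    refine ⟨hne, fun h => ?_⟩
    obtain ⟨i, hi⟩ := nonempty_iff_ne_empty.2 hne
    exact hdc (ν.part.eq_of_mem_parts hd hc (mem_restrictLast.1 hi)
      (mem_restrictLast.1 (h ▸ hi)))
  have himage : ∀ s ⊆ ν.part.parts,
      ((((insert c s).image restrictLast).erase ∅).erase (restrictLast c)).image liftSucc =
        s.erase c := by
    intro s hs
    ext d
    simp only [mem_image, mem_erase, mem_insert]
    constructor
    · rintro ⟨_, ⟨h1, h2, e, he, rfl⟩, rfl⟩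
      have hec : e ≠ c := fun h => h1 (h ▸ rfl)
      have hes := he.resolve_left hec
      rw [liftSucc_restrictLast (hnot e (hs hes) hec)]
      exact ⟨hec, hes⟩
    · rintro ⟨hdc, hd⟩
      have := hdisj d (hs hd) hdc
      exact ⟨_, ⟨this.2, this.1, d, Or.inr hd, rfl⟩, liftSucc_restrictLast (hnot d (hs hd) hdc)⟩
  refine ⟨ν.removeLast, restrictLast c, decide (c ∈ ν.opens), ?_, ext_parts ?_ ?_⟩
  · simp only [removeLast, ← hcdef, mem_insert, mem_erase, mem_image]
    exact or_iff_not_imp_left.2 fun h => ⟨h, c, Or.inl rfl, rfl⟩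
  · have := himage ν.part.parts subset_rfl
    rw [insert_eq_of_mem hc] at this
    rw [parts_addLast, hins]
    change insert c ((((ν.part.parts.image restrictLast).erase ∅).erase _).image liftSucc) = _
    rw [this, insert_erase hc]
  · rw [opens_addLast, hins]
    change _ ∪ (((((insert c ν.opens).image restrictLast).erase ∅).erase _).image liftSucc) = _
    rw [himage ν.opens ν.opens_subset]
    by_cases h : c ∈ ν.opens
    · simp [h, insert_erase h]
    · simp [h]

/-- Summation over marked partitions of `[n + 1]` according to the position of `n + 1`. -/
lemma sum_succ (f : MarkedPartition (n + 1) → ℤ)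
    (g : MarkedPartition n → Finset (Fin n) → Bool → ℤ)
    (hfg : ∀ μ b t hb, f (addLast μ b t hb) = g μ b t) :
    ∑ ν, f ν = ∑ μ, ((g μ ∅ true + g μ ∅ false) + ∑ b ∈ μ.opens, (g μ b true + g μ b false)) := by
  have h : ∑ x ∈ univ.sigma fun μ : MarkedPartition n =>
      (insert ∅ μ.opens ×ˢ (univ : Finset Bool)), g x.1 x.2.1 x.2.2 = ∑ ν, f ν := by
    refine sum_bij (fun x hx => addLast x.1 x.2.1 x.2.2
      (mem_product.1 (mem_sigma.1 hx).2).1) (fun _ _ => mem_univ _) ?_ ?_ ?_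
    · rintro ⟨μ, b, t⟩ _ ⟨ν, c, u⟩ _ h
      obtain ⟨rfl, rfl, rfl⟩ := addLast_injective h
      rfl
    · intro ν _
      obtain ⟨μ, b, t, hb, h⟩ := ν.exists_addLast_eq
      exact ⟨⟨μ, b, t⟩, mem_sigma.2 ⟨mem_univ _, mem_product.2 ⟨hb, mem_univ _⟩⟩, h⟩
    · exact fun _ _ => (hfg _ _ _ _).symm
  rw [← h, sum_sigma]
  refine sum_congr rfl fun μ _ => ?_
  rw [sum_product, sum_insert μ.empty_notMem_opens]
  simp

end MarkedPartition

/-- The binomial sums of moments are moments of the shifted exponent. -/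
lemma sum_choose_mul_Mdim (k n : ℕ) (A x : ℤ) :
    ∑ j ∈ range (k + 1), (k.choose j : ℤ) * x ^ (k - j) * Mdim j n A =
      ∑ μ : MarkedPartition n, if (μ.o : ℤ) = A then (μ.dtilde + x) ^ k else 0 := by
  simp only [Mdim, mul_sum]
  rw [sum_comm, sum_filter]
  refine sum_congr rfl fun μ _ => ?_
  rw [add_pow]
  congr 1
  exact sum_congr rfl fun j _ => by ring

/-- The recursion for the moments `M_k(d; n, A)`. -/
theorem Mdim_recursion (n : ℕ) (hn : 1 ≤ n) (k : ℕ) (A : ℤ) (hA : 0 ≤ A) :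
    Mdim k n A =
      (∑ j ∈ Finset.range (k + 1),
          (k.choose j : ℤ) * (A - 1) ^ (k - j) * Mdim j (n - 1) (A - 1))
      + (∑ j ∈ Finset.range (k + 1),
          (k.choose j : ℤ) * A ^ (k - j) * Mdim j (n - 1) A)
      + A * (∑ j ∈ Finset.range (k + 1),
          (k.choose j : ℤ) * (A - 1) ^ (k - j) * Mdim j (n - 1) A)
      + (A + 1) * (∑ j ∈ Finset.range (k + 1),
          (k.choose j : ℤ) * A ^ (k - j) * Mdim j (n - 1) (A + 1)) := by
  obtain ⟨n, rfl⟩ := Nat.exists_eq_add_of_le' hn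
  simp only [Nat.add_sub_cancel, sum_choose_mul_Mdim]
  rw [Mdim, sum_filter, MarkedPartition.sum_succ _ (fun μ b t =>
    if (μ.o : ℤ) - (if b = ∅ then 0 else 1) + (if t then 1 else 0) = A
    then (μ.dtilde + (A - 1 + (if t then 0 else 1))) ^ k else 0)]
  · simp only [mul_sum, ← sum_add_distrib]
    refine sum_congr rfl fun μ _ => ?_
    have hopen : ∀ b ∈ μ.opens, b ≠ ∅ := fun b hb h => μ.empty_notMem_opens (h ▸ hb)
    rw [sum_congr rfl fun b hb => by rw [if_neg (hopen b hb)], sum_const, nsmul_eq_mul,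
      ← MarkedPartition.o]
    simp only [if_true, Bool.false_eq_true, if_false, sub_zero, add_zero, sub_add_cancel,
      ← eq_sub_iff_add_eq, sub_eq_iff_eq_add]
    split_ifs <;> first | omega | (simp_all; try ring)
  · intro μ b t hb
    rw [MarkedPartition.dtilde_addLast, ← MarkedPartition.o_addLast μ b t hb]
    split_ifs with h <;> simp [h]
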